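/- SCC decomposition after removing ranked transitions: Let V be a VASS of dimension n and let T ⊆ Trns(V) be the set of transitions t for which constraint system (B_t) is satisfiable (i.e., there exist r ∈ ℤ^n, z ∈ ℤ^{Locs(V)} with r ≥ 0, z ≥ 0 and D^T r + F^T z ≤ 0 with strict inequality in row t). Then V' = (Locs(V), Trns(V) \ T) can be fully decomposed into strongly-connected components, i.e., every transition of V' belongs to some SCC of V'. -/

import Mathlib

namespace VASSPaper

abbrev Val (n : ℕ) := Fin n → ℕ
abbrev Upd (n : ℕ) := Fin n → ℤ
abbrev Transition (n : ℕ) (L : Type) := L × Upd n × L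

/-- A vector addition system with states: a finite set of locations and a finite
set of transitions between locations, labelled by integer update vectors. -/
structure VASS (n : ℕ) (L : Type) where
  Locs : Finset L
  Trns : Finset (Transition n L)
  valid : ∀ t ∈ Trns, t.1 ∈ Locs ∧ t.2.2 ∈ Locs

variable {n : ℕ} {L : Type}

/-- A step of the VASS: the transition is in the system and the (non-negative)
valuation is updated by the update vector. -/
def Step (V : VASS n L) (s : L × Val n) (d : Upd n) (s' : L × Val n) : Prop :=
  (s.1, d, s'.1) ∈ V.Trns ∧ ∀ i, (s'.2 i : ℤ) = (s.2 i : ℤ) + d i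

/-- An infinite trace. -/
def InfTrace (V : VASS n L) (ℓ : ℕ → L) (v : ℕ → Val n) (d : ℕ → Upd n) : Prop :=
  ∀ i, Step V (ℓ i, v i) (d i) (ℓ (i + 1), v (i + 1))

/-- A finite trace of length `k`. -/
def FinTrace (V : VASS n L) (k : ℕ) (ℓ : ℕ → L) (v : ℕ → Val n) (d : ℕ → Upd n) : Prop :=
  ∀ i < k, Step V (ℓ i, v i) (d i) (ℓ (i + 1), v (i + 1))

/-- `V` is terminating if it has no infinite trace. -/
def Terminating (V : VASS n L) : Prop := ¬ ∃ ℓ v d, InfTrace V ℓ v d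

/-- A path, given as a list of transitions of `V` with matching endpoints. -/
def IsPath (V : VASS n L) (π : List (Transition n L)) : Prop :=
  (∀ t ∈ π, t ∈ V.Trns) ∧ π.Chain' (fun t₁ t₂ => t₁.2.2 = t₂.1)

/-- The value of a path: the sum of its update vectors. -/
def pathVal (π : List (Transition n L)) : Upd n := (π.map (fun t => t.2.1)).sum

/-- A cycle: a non-empty path whose start location equals its end location. -/
def IsCycle (V : VASS n L) (π : List (Transition n L)) : Prop :=
  IsPath V π ∧ π ≠ [] ∧ π.head?.map (fun t => t.1) = π.getLast?.map (fun t => t.2.2)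

/-- A multi-cycle: a finite collection of cycles. -/
def IsMultiCycle (V : VASS n L) (M : List (List (Transition n L))) : Prop :=
  ∀ C ∈ M, IsCycle V C

/-- The value of a multi-cycle: the sum of the values of its cycles. -/
def multiVal (M : List (List (Transition n L))) : Upd n := (M.map pathVal).sum

/-- A state is `N`-bounded if each component of its valuation is at most `N`. -/
def NBounded (V : VASS n L) (N : ℕ) (s : L × Val n) : Prop :=
  s.1 ∈ V.Locs ∧ ∀ i, s.2 i ≤ N

/-- `s'` is reachable from `s` by a finite trace. -/
def ReachableFrom (V : VASS n L) (s s' : L × Val n) : Prop :=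
  ∃ k ℓ v d, FinTrace V k ℓ v d ∧ (ℓ 0, v 0) = s ∧ (ℓ k, v k) = s'

/-- The computational complexity: the length of the longest trace starting in an
`N`-bounded state. -/
noncomputable def compN (V : VASS n L) (N : ℕ) : ℕ :=
  sSup { k | ∃ ℓ v d, NBounded V N (ℓ 0, v 0) ∧ FinTrace V k ℓ v d }

/-- A quasi-ranking function: weakly decreasing along every step. -/
def QuasiRanking (V : VASS n L) (q : L × Val n → ℕ) : Prop :=
  ∀ s d s', Step V s d s' → q s' ≤ q s

/-- `q` is ranking for transition `t`: strictly decreasing along every step taken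
along `t`. -/
def RankingFor (V : VASS n L) (q : L × Val n → ℕ) (t : Transition n L) : Prop :=
  ∀ s d s', Step V s d s' → (s.1, d, s'.1) = t → q s' < q s

/-- The (strict) lexicographic order on finite sequences of naturals, as in the paper:
`x >lex y` iff there is an index (within both sequences) where `x` is larger and all
earlier entries agree. -/
def LexGt (x y : List ℕ) : Prop :=
  ∃ i, i < x.length ∧ i < y.length ∧ y.getD i 0 < x.getD i 0 ∧
    ∀ j < i, x.getD j 0 = y.getD j 0

/-- A lexicographic ranking function of order `k` for `V`. -/
def IsLexRankingOfOrder (V : VASS n L) (k : ℕ) (f : L × Val n → List ℕ) : Prop :=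
  (∀ s : L × Val n, s.1 ∈ V.Locs → (f s).length ≤ k) ∧
  ∀ s d s', Step V s d s' → LexGt (f s) (f s')

def SubVASS (S V : VASS n L) : Prop := S.Locs ⊆ V.Locs ∧ S.Trns ⊆ V.Trns

/-- There is a path (possibly empty) from `l` to `l'`. -/
def Reaches (V : VASS n L) (l l' : L) : Prop :=
  Relation.ReflTransGen (fun a b => ∃ d, (a, d, b) ∈ V.Trns) l l'

/-- `V` is connected: every location can reach every other location. -/
def ConnectedV (V : VASS n L) : Prop :=
  ∀ l ∈ V.Locs, ∀ l' ∈ V.Locs, Reaches V l l'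

/-- A strongly connected component: a maximal connected sub-VASS. -/
def IsSCC (V S : VASS n L) : Prop :=
  SubVASS S V ∧ ConnectedV S ∧
    ∀ S', SubVASS S' V → ConnectedV S' → SubVASS S S' → SubVASS S' S

/-- `V` can be fully decomposed into SCCs: every transition belongs to some SCC. -/
def FullyDecomposable (V : VASS n L) : Prop :=
  ∀ t ∈ V.Trns, ∃ S, IsSCC V S ∧ t ∈ S.Trns

/-- The Kosaraju–Sullivan constraints (1)–(3): `Dμ ≥ 0`, `μ ≥ 0` and `Fμ = 0`
(the latter written out entrywise, with the oriented incidence matrix). -/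
def NonNegCombo [DecidableEq L] (V : VASS n L) (μ : Transition n L → ℤ) : Prop :=
  (∀ i : Fin n, 0 ≤ ∑ t ∈ V.Trns, t.2.1 i * μ t) ∧
  (∀ t ∈ V.Trns, 0 ≤ μ t) ∧
  (∀ l ∈ V.Locs,
    ∑ t ∈ V.Trns, ((if t.1 = l then (1 : ℤ) else 0) - (if t.2.2 = l then 1 else 0)) * μ t = 0)

/-- Constraint system (A_t). -/
def SatA [DecidableEq L] (V : VASS n L) (t₀ : Transition n L) : Prop :=
  ∃ μ : Transition n L → ℤ, NonNegCombo V μ ∧ 1 ≤ μ t₀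

/-- Constraint system (B_t): `r ≥ 0`, `z ≥ 0` and `Dᵀr + Fᵀz ≤ 0`, with strict
inequality in row `t₀` (the row of `Fᵀz` at a transition `t` is `z(src t) - z(tgt t)`). -/
def SatB (V : VASS n L) (t₀ : Transition n L) : Prop :=
  ∃ (r : Fin n → ℤ) (z : L → ℤ),
    (∀ i, 0 ≤ r i) ∧ (∀ l ∈ V.Locs, 0 ≤ z l) ∧
    (∀ t ∈ V.Trns, (∑ i, t.2.1 i * r i) + z t.1 - z t.2.2 ≤ 0) ∧
    (∑ i, t₀.2.1 i * r i) + z t₀.1 - z t₀.2.2 < 0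

/-- The cone of cycle values of `V` (over ℚ). -/
def coneSet [DecidableEq L] (V : VASS n L) : Set (Fin n → ℚ) :=
  { x | ∃ μ : Transition n L → ℚ, (∀ t ∈ V.Trns, 0 ≤ μ t) ∧
      (∀ l ∈ V.Locs,
        ∑ t ∈ V.Trns, ((if t.1 = l then (1 : ℚ) else 0) - (if t.2.2 = l then 1 else 0)) * μ t = 0) ∧
      x = fun i => ∑ t ∈ V.Trns, (t.2.1 i : ℚ) * μ t }

/-- The dimension of the smallest vector space containing the cone of `V`. -/
noncomputable def coneDim [DecidableEq L] (V : VASS n L) : ℕ :=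
  Module.finrank ℚ (Submodule.span ℚ (coneSet V))

/-- Conservative VASS: the entries of each update vector sum to zero. -/
def Conservative (V : VASS n L) : Prop := ∀ t ∈ V.Trns, ∑ i, t.2.1 i = 0

/-- The feasible region of the rational LP (C): `ρ ≥ 0`, `Dρ ≥ -1`, `Fρ = 0`. -/
def FeasC [DecidableEq L] (V : VASS n L) (ρ : Transition n L → ℚ) : Prop :=
  (∀ t ∈ V.Trns, 0 ≤ ρ t) ∧
  (∀ i : Fin n, (-1 : ℚ) ≤ ∑ t ∈ V.Trns, (t.2.1 i : ℚ) * ρ t) ∧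
  (∀ l ∈ V.Locs,
    ∑ t ∈ V.Trns, ((if t.1 = l then (1 : ℚ) else 0) - (if t.2.2 = l then 1 else 0)) * ρ t = 0)
/-- Reachability is monotone in the set of transitions. -/
theorem Reaches.mono {n : ℕ} {L : Type} {V W : VASS n L} (h : V.Trns ⊆ W.Trns) {l l' : L}
    (hl : Reaches V l l') : Reaches W l l' :=
  Relation.ReflTransGen.mono (fun _ _ ⟨d, hd⟩ => ⟨d, h hd⟩) _ _ hl

/-- The sub-VASS of the locations mutually reachable with `a`. -/
noncomputable def component {n : ℕ} {L : Type} (V : VASS n L) (a : L) : VASS n L := by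
  classical
  exact
    { Locs := V.Locs.filter fun l => Reaches V a l ∧ Reaches V l a
      Trns := V.Trns.filter fun t =>
        (Reaches V a t.1 ∧ Reaches V t.1 a) ∧ Reaches V a t.2.2 ∧ Reaches V t.2.2 a
      valid := fun t ht => by
        simp only [Finset.mem_filter] at ht ⊢
        exact ⟨⟨(V.valid t ht.1).1, ht.2.1⟩, (V.valid t ht.1).2, ht.2.2⟩ }

theorem mem_component_locs {n : ℕ} {L : Type} {V : VASS n L} {a l : L} :
    l ∈ (component V a).Locs ↔ l ∈ V.Locs ∧ Reaches V a l ∧ Reaches V l a := by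
  simp [component]

theorem mem_component_trns {n : ℕ} {L : Type} {V : VASS n L} {a : L} {t : Transition n L} :
    t ∈ (component V a).Trns ↔ t ∈ V.Trns ∧
      (Reaches V a t.1 ∧ Reaches V t.1 a) ∧ Reaches V a t.2.2 ∧ Reaches V t.2.2 a := by
  simp [component]

theorem Reaches.component {n : ℕ} {L : Type} {V : VASS n L} {a x y : L}
    (h : Reaches V x y) (hx : Reaches V a x) (hy : Reaches V y a) :
    Reaches (component V a) x y := by
  induction h using Relation.ReflTransGen.head_induction_on with
  | refl => exact Relation.ReflTransGen.refl
  | @head x c hxc hcy ih =>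
    have hac : Reaches V a c := Relation.ReflTransGen.tail hx hxc
    have hca : Reaches V c a := Relation.ReflTransGen.trans hcy hy
    have hxa : Reaches V x a := Relation.ReflTransGen.head hxc hca
    obtain ⟨d, hd⟩ := hxc
    exact Relation.ReflTransGen.head
      ⟨d, mem_component_trns.2 ⟨hd, ⟨hx, hxa⟩, hac, hca⟩⟩ (ih hac)

theorem isSCC_component {n : ℕ} {L : Type} {V : VASS n L} {a : L} (ha : a ∈ V.Locs) :
    IsSCC V (component V a) := by
  refine ⟨⟨fun l hl => (mem_component_locs.1 hl).1, fun t ht => (mem_component_trns.1 ht).1⟩,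
    fun l hl l' hl' => ?_, fun S hSV hS hsub => ?_⟩
  · obtain ⟨-, hal, hla⟩ := mem_component_locs.1 hl
    obtain ⟨-, hal', hla'⟩ := mem_component_locs.1 hl'
    exact Reaches.component (Relation.ReflTransGen.trans hla hal') hal hla'
  · have haS : a ∈ S.Locs :=
      hsub.1 (mem_component_locs.2 ⟨ha, Relation.ReflTransGen.refl, Relation.ReflTransGen.refl⟩)
    have key : ∀ l ∈ S.Locs, Reaches V a l ∧ Reaches V l a := fun l hl =>
      ⟨(hS a haS l hl).mono hSV.2, (hS l hl a haS).mono hSV.2⟩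
    exact ⟨fun l hl => mem_component_locs.2 ⟨hSV.1 hl, key l hl⟩,
      fun t ht => mem_component_trns.2
        ⟨hSV.2 ht, key _ (S.valid t ht).1, key _ (S.valid t ht).2⟩⟩

/-- If the target of every transition reaches its source, then `V` is fully decomposable. -/
theorem fullyDecomposable_of_reaches {n : ℕ} {L : Type} {V : VASS n L}
    (h : ∀ t ∈ V.Trns, Reaches V t.2.2 t.1) : FullyDecomposable V := fun t ht =>
  ⟨component V t.1, isSCC_component (V.valid t ht).1, mem_component_trns.2
    ⟨ht, ⟨Relation.ReflTransGen.refl, Relation.ReflTransGen.refl⟩,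
      Relation.ReflTransGen.single ⟨t.2.1, ht⟩, h t ht⟩⟩

/-- Solutions of the systems (B_t) add up to one that is strict for all `t` in a finite set. -/
theorem exists_common_satB {n : ℕ} {L : Type} (V : VASS n L) (T : Finset (Transition n L))
    (hT : ∀ t ∈ T, t ∈ V.Trns ∧ SatB V t) :
    ∃ (r : Fin n → ℤ) (z : L → ℤ), (∀ i, 0 ≤ r i) ∧ (∀ l ∈ V.Locs, 0 ≤ z l) ∧
      (∀ t ∈ V.Trns, (∑ i, t.2.1 i * r i) + z t.1 - z t.2.2 ≤ 0) ∧
      ∀ t ∈ T, (∑ i, t.2.1 i * r i) + z t.1 - z t.2.2 < 0 := by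
  classical
  induction T using Finset.induction_on with
  | empty => exact ⟨0, 0, by simp⟩
  | insert t₀ T _ ih =>
    obtain ⟨r, z, hr, hz, hle, hlt⟩ := ih fun t ht => hT t (Finset.mem_insert_of_mem ht)
    obtain ⟨ht₀, r', z', hr', hz', hle', hlt'⟩ := hT t₀ (Finset.mem_insert_self _ _)
    refine ⟨r + r', z + z', fun i => add_nonneg (hr i) (hr' i),
      fun l hl => add_nonneg (hz l hl) (hz' l hl), fun t ht => ?_, fun t ht => ?_⟩
    · have h₁ := hle t ht
      have h₂ := hle' t ht
      simp only [Pi.add_apply, mul_add, Finset.sum_add_distrib]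
      linarith
    · simp only [Pi.add_apply, mul_add, Finset.sum_add_distrib]
      rcases Finset.mem_insert.1 ht with rfl | ht
      · have := hle t ht₀
        linarith
      · have h₁ := hlt t ht
        have h₂ := hle' t (hT t (Finset.mem_insert_of_mem ht)).1
        linarith

/-- **SCC decomposition after removing ranked transitions.** If `T` is the set of
transitions for which (B_t) is satisfiable, then `V' = (Locs(V), Trns(V) \ T)` can be
fully decomposed into strongly connected components. -/
theorem scc_decomposition_after_removal {n : ℕ} {L : Type} [DecidableEq L]
    (V V' : VASS n L) (T : Finset (Transition n L))
    (hTmem : ∀ t, t ∈ T ↔ t ∈ V.Trns ∧ SatB V t)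
    (hV'L : V'.Locs = V.Locs) (hV'T : V'.Trns = V.Trns \ T) :
    FullyDecomposable V' := by
  classical
  refine fullyDecomposable_of_reaches fun t₀ ht₀ => ?_
  by_contra hreach
  obtain ⟨ht₀V, ht₀T⟩ := Finset.mem_sdiff.1 (hV'T ▸ ht₀)
  obtain ⟨r, z, hr, hz, hle, hlt⟩ := exists_common_satB V T fun t ht => (hTmem t).1 ht
  refine ht₀T ((hTmem t₀).2 ⟨ht₀V, r, fun l => z l + if Reaches V' t₀.2.2 l then 1 else 0, hr,
    fun l hl => ?_, fun t ht => ?_, ?_⟩)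
  · have := hz l hl
    dsimp only
    split_ifs <;> lia
  · dsimp only
    by_cases htT : t ∈ T
    · have := hlt t htT
      split_ifs <;> lia
    · have := hle t ht
      have ht' : t ∈ V'.Trns := hV'T ▸ Finset.mem_sdiff.2 ⟨ht, htT⟩
      have hstep : Reaches V' t₀.2.2 t.1 → Reaches V' t₀.2.2 t.2.2 := fun h =>
        Relation.ReflTransGen.tail h ⟨t.2.1, ht'⟩
      split_ifs <;> lia
  · have hrefl : Reaches V' t₀.2.2 t₀.2.2 := Relation.ReflTransGen.refl
    have := hle t₀ ht₀V
    simp only [if_neg hreach, if_pos hrefl]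
    lia

end VASSPaper
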